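/- Let U be a closed convex set in a finite-dimensional real inner product space 𝔼, φ : 𝔼 → ℝ a convex function, u ∈ 𝔼, and λ > 0. Define μ(z) = φ(z) + (2λ)^{−1}‖z − u‖² and let v be a minimizer of μ over U. Then 2λ(φ(v) − φ(z)) ≤ ‖z − u‖² − ‖z − v‖² − ‖v − u‖² for all z ∈ U. -/

import Mathlib

theorem statement_7 {E : Type*} [NormedAddCommGroup E] [InnerProductSpace ℝ E]
    [FiniteDimensional ℝ E]
    (U : Set E) (hUcl : IsClosed U) (hUconv : Convex ℝ U)
    (φ : E → ℝ) (hφ : ConvexOn ℝ Set.univ φ)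
    (u : E) (lam : ℝ) (hlam : 0 < lam)
    (v : E) (hvU : v ∈ U)
    (hmin : ∀ z ∈ U,
      φ v + (2 * lam)⁻¹ * ‖v - u‖ ^ 2 ≤ φ z + (2 * lam)⁻¹ * ‖z - u‖ ^ 2) :
    ∀ z ∈ U, 2 * lam * (φ v - φ z) ≤ ‖z - u‖ ^ 2 - ‖z - v‖ ^ 2 - ‖v - u‖ ^ 2 := by
  intro z hz
  have hexp : ∀ t : ℝ, ‖v + t • (z - v) - u‖ ^ 2
      = ‖v - u‖ ^ 2 + 2 * t * inner ℝ (v - u) (z - v) + t ^ 2 * ‖z - v‖ ^ 2 := by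
    intro t
    have h : v + t • (z - v) - u = (v - u) + t • (z - v) := by abel
    rw [h, norm_add_sq_real, inner_smul_right, norm_smul, mul_pow, Real.norm_eq_abs, sq_abs]
    ring
  have h1 := hexp 1
  rw [one_smul, add_sub_cancel] at h1
  have key : ∀ t : ℝ, 0 < t → t ≤ 1 →
      2 * lam * (φ v - φ z) - 2 * inner ℝ (v - u) (z - v) ≤ t * ‖z - v‖ ^ 2 := by
    intro t ht ht1
    have hw : (1 - t) • v + t • z = v + t • (z - v) := by
      rw [sub_smul, smul_sub, one_smul]; abel
    have hU := hUconv hvU hz (sub_nonneg.2 ht1) ht.le (by ring)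
    have hc := hφ.2 (Set.mem_univ v) (Set.mem_univ z) (sub_nonneg.2 ht1) ht.le (by ring)
    rw [hw] at hU hc
    have hm := hmin _ hU
    rw [hexp t] at hm
    simp only [smul_eq_mul] at hc
    have hm2 : φ v + (2 * lam)⁻¹ * ‖v - u‖ ^ 2 ≤ (1 - t) * φ v + t * φ z + (2 * lam)⁻¹ *
      (‖v - u‖ ^ 2 + 2 * t * inner ℝ (v - u) (z - v) + t ^ 2 * ‖z - v‖ ^ 2) := by linarith
    have hm3 := mul_le_mul_of_nonneg_left hm2 (by positivity : 0 ≤ 2 * lam)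
    have hl : 2 * lam ≠ 0 := by positivity
    rw [mul_add, mul_add (2 * lam) ((1 - t) * φ v + t * φ z),
      mul_inv_cancel_left₀ hl, mul_inv_cancel_left₀ hl] at hm3
    refine le_of_mul_le_mul_left ?_ ht
    linarith
  have hA : 2 * lam * (φ v - φ z) - 2 * inner ℝ (v - u) (z - v) ≤ 0 := by
    by_contra! hA
    set A := 2 * lam * (φ v - φ z) - 2 * inner ℝ (v - u) (z - v)
    have hD : 0 ≤ ‖z - v‖ ^ 2 := by positivity
    have hAD : 0 < A + ‖z - v‖ ^ 2 := by linarith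
    have hk := key (A / (A + ‖z - v‖ ^ 2)) (by positivity)
      ((div_le_one hAD).2 (by linarith))
    rw [div_mul_eq_mul_div, le_div_iff₀ hAD] at hk
    nlinarith
  linarith
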